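/- arXiv:0912.0555 — 3 statements merged into one kernel-verified Lean document; each statement's English description precedes it below -/
import Mathlib

section
/- Bisimilarity is a congruence for choice in the wire calculus: if P, Q, R : (k,l) are closed sorted terms and P ∼ Q, then P+R ∼ Q+R and R+P ∼ R+Q. -/
/-!
# The wire calculus

Signals are drawn from an alphabet `Sig`; a label letter is `Option Sig`,
where `none` represents `ι` (absence of signal) and `some σ` a signal `σ ∈ Σ`.
Labels of transitions are pairs of words (lists) of such letters.
-/

namespace WireCalc

/-- Prefix atoms. `fvar n` is a free occurrence of the signal variable `n`,
`bvar n` is a binding occurrence `λn`, and `const a` is a constant: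
`const none` is `ι` and `const (some σ)` is the signal `σ ∈ Σ`. -/
inductive Atom (Sig : Type) : Type
  | fvar : ℕ → Atom Sig
  | bvar : ℕ → Atom Sig
  | const : Option Sig → Atom Sig

/-- Wire calculus terms. Process variables are de Bruijn indices;
`mu k l P` is `μY:(k,l).P`, binding index `0` in `P`.
`pre u v P` is the prefix `u/v.P`. -/
inductive Term (Sig : Type) : Type
  | pvar : ℕ → Term Sig
  | seq : Term Sig → Term Sig → Term Sig
  | ten : Term Sig → Term Sig → Term Sig
  | pre : List (Atom Sig) → List (Atom Sig) → Term Sig → Term Sig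
  | choice : Term Sig → Term Sig → Term Sig
  | mu : ℕ → ℕ → Term Sig → Term Sig

variable {Sig : Type}

def Atom.isBindOf (n : ℕ) : Atom Sig → Bool
  | .bvar m => m = n
  | _ => false

def Atom.isFreeOf (n : ℕ) : Atom Sig → Bool
  | .fvar m => m = n
  | _ => false

def Atom.isFvar : Atom Sig → Bool
  | .fvar _ => true
  | _ => false

/-- The signal variable `n` is bound by the prefix `u/v`
(i.e. `λn` occurs in `uv`). -/
def boundIn (n : ℕ) (u v : List (Atom Sig)) : Bool := (u ++ v).any (Atom.isBindOf n)

/-- The signal variable `n` occurs freely in the prefix `u/v`. -/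
def freeIn (n : ℕ) (u v : List (Atom Sig)) : Bool := (u ++ v).any (Atom.isFreeOf n)

/-- `bd(u/v)`: the set of signal variables bound by the prefix `u/v`. -/
def bdSet (u v : List (Atom Sig)) : Set ℕ := {n | boundIn n u v}

/-- `fr(u/v)`: the set of signal variables occurring freely in the prefix `u/v`. -/
def frSet (u v : List (Atom Sig)) : Set ℕ := {n | freeIn n u v}

/-- Substitution of constants for free signal variables in an atom.
`σ n = some a` means `n` is replaced by the constant `a`. -/
def Atom.substS (σ : ℕ → Option (Option Sig)) : Atom Sig → Atom Sig
  | .fvar n =>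
      match σ n with
      | some a => .const a
      | none => .fvar n
  | .bvar n => .bvar n
  | .const a => .const a

/-- Substitution of constants for free signal variables in a term;
variables bound by an inner prefix are shadowed and not substituted
under that prefix. -/
def Term.substS (σ : ℕ → Option (Option Sig)) : Term Sig → Term Sig
  | .pvar i => .pvar i
  | .seq P Q => .seq (P.substS σ) (Q.substS σ)
  | .ten P Q => .ten (P.substS σ) (Q.substS σ)
  | .pre u v P => .pre (u.map (Atom.substS σ)) (v.map (Atom.substS σ))
      (P.substS fun n => if boundIn n u v then none else σ n)
  | .choice P Q => .choice (P.substS σ) (Q.substS σ)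
  | .mu k l P => .mu k l (P.substS σ)

/-- Shifting of process variables `≥ c` by `d` (standard de Bruijn machinery). -/
def shiftP (d : ℕ) : ℕ → Term Sig → Term Sig
  | c, .pvar i => .pvar (if c ≤ i then i + d else i)
  | c, .seq P Q => .seq (shiftP d c P) (shiftP d c Q)
  | c, .ten P Q => .ten (shiftP d c P) (shiftP d c Q)
  | c, .pre u v P => .pre u v (shiftP d c P)
  | c, .choice P Q => .choice (shiftP d c P) (shiftP d c Q)
  | c, .mu k l P => .mu k l (shiftP d (c + 1) P)

/-- Capture-avoiding substitution `substP j S P = P[S / (pvar j)]` of a term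
for a process variable. -/
def substP : ℕ → Term Sig → Term Sig → Term Sig
  | j, S, .pvar i => if i = j then S else if j < i then .pvar (i - 1) else .pvar i
  | j, S, .seq P Q => .seq (substP j S P) (substP j S Q)
  | j, S, .ten P Q => .ten (substP j S P) (substP j S Q)
  | j, S, .pre u v P => .pre u v (substP j S P)
  | j, S, .choice P Q => .choice (substP j S P) (substP j S Q)
  | j, S, .mu k l P => .mu k l (substP (j + 1) (shiftP 1 0 S) P)

/-- The sorting judgement `Sorted Γ Δ P k l`, i.e. `Γ; Δ ⊢ P : (k, l)`,
where `Γ` is the (de Bruijn) context of process variables with their sorts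
and `Δ` the set of signal variables in scope. -/
inductive Sorted : List (ℕ × ℕ) → Set ℕ → Term Sig → ℕ → ℕ → Prop
  | pvar {Γ : List (ℕ × ℕ)} {Δ : Set ℕ} {i k l} :
      Γ[i]? = some (k, l) → Sorted Γ Δ (.pvar i) k l
  | seq {Γ Δ P Q k n l} : Sorted Γ Δ P k n → Sorted Γ Δ Q n l →
      Sorted Γ Δ (.seq P Q) k l
  | ten {Γ Δ P Q k l m n} : Sorted Γ Δ P k l → Sorted Γ Δ Q m n →
      Sorted Γ Δ (.ten P Q) (k + m) (l + n)
  | pre {Γ Δ u v P k l} : u.length = k → v.length = l →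
      frSet u v ∩ bdSet u v = ∅ → frSet u v ⊆ Δ →
      Sorted Γ (Δ ∪ bdSet u v) P k l → Sorted Γ Δ (.pre u v P) k l
  | choice {Γ Δ P Q k l} : Sorted Γ Δ P k l → Sorted Γ Δ Q k l →
      Sorted Γ Δ (.choice P Q) k l
  | mu {Γ Δ P k' l' k l} : Sorted ((k', l') :: Γ) Δ P k l →
      Sorted Γ Δ (.mu k' l' P) k l

/-- The word `ι⃗` of length `k`, consisting solely of `ι`'s. -/
def iotaW (Sig : Type) (k : ℕ) : List (Option Sig) := List.replicate k none

/-- A word consists solely of `ι`'s. -/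
def IsIota (w : List (Option Sig)) : Prop := ∀ x ∈ w, x = none

/-- Instantiation of a prefix atom to a label letter along a substitution `σ`
of the bound signal variables. -/
def instAtom (σ : ℕ → Option Sig) : Atom Sig → Option Sig
  | .fvar n => σ n
  | .bvar n => σ n
  | .const a => a

/-- The operational semantics of the wire calculus: `Step P a b Q` means
`P →[a/b] Q`.  The rules are Refl, ιL, ιR, Cut, Ten, Pref, +ι, +L, +R, Rec. -/
inductive Step : Term Sig → List (Option Sig) → List (Option Sig) → Term Sig → Prop
  | refl {P : Term Sig} {k l : ℕ} :
      Sorted [] ∅ P k l → Step P (iotaW Sig k) (iotaW Sig l) P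
  | iotaL {P R Q : Term Sig} {a' b' a b} :
      IsIota a' → IsIota b' → Step P a' b' R → Step R a b Q → Step P a b Q
  | iotaR {P R Q : Term Sig} {a b a' b'} :
      Step P a b R → IsIota a' → IsIota b' → Step R a' b' Q → Step P a b Q
  | cut {P Q R S : Term Sig} {a b c} :
      Step P a c Q → Step R c b S → Step (.seq P R) a b (.seq Q S)
  | ten {P Q R S : Term Sig} {a b c d} :
      Step P a b Q → Step R c d S → Step (.ten P R) (a ++ c) (b ++ d) (.ten Q S)
  | pref {u v : List (Atom Sig)} {P : Term Sig} (σ : ℕ → Option Sig)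
      (hnofree : ∀ x ∈ u ++ v, x.isFvar = false) :
      Step (.pre u v P) (u.map (instAtom σ)) (v.map (instAtom σ))
        (P.substS fun n => if boundIn n u v then some (σ n) else none)
  | choiceIota {P Q R S : Term Sig} {a b} :
      IsIota a → IsIota b → Step P a b Q → Step R a b S →
      Step (.choice P R) a b (.choice Q S)
  | choiceL {P Q R : Term Sig} {a b} :
      ¬ IsIota (a ++ b) → Step P a b Q → Step (.choice P R) a b Q
  | choiceR {P Q R : Term Sig} {a b} :
      ¬ IsIota (a ++ b) → Step R a b Q → Step (.choice P R) a b Q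
  | recur {k l : ℕ} {P Q : Term Sig} {a b} :
      Step (substP 0 (.mu k l P) P) a b Q → Step (.mu k l P) a b Q

/-- A chain of transitions with the given list of labels. -/
inductive MultiStep :
    Term Sig → List (List (Option Sig) × List (Option Sig)) → Term Sig → Prop
  | nil (P : Term Sig) : MultiStep P [] P
  | cons {P Q R : Term Sig} {a b ls} :
      Step P a b Q → MultiStep Q ls R → MultiStep P ((a, b) :: ls) R

/-- `S` is a simulation on the LTS of the wire calculus. -/
def IsSim (S : Term Sig → Term Sig → Prop) : Prop :=
  ∀ P Q, S P Q → ∀ a b P', Step P a b P' → ∃ Q', Step Q a b Q' ∧ S P' Q'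

/-- (Strong) bisimilarity `P ∼ Q` of wire calculus terms: some relation
containing `(P, Q)` is a bisimulation, i.e. it and its inverse are simulations. -/
def Bisim (P Q : Term Sig) : Prop :=
  ∃ S : Term Sig → Term Sig → Prop, IsSim S ∧ IsSim (flip S) ∧ S P Q

/-! ## Wire constants -/

/-- The word of binders `λx₁…λxₘ`. -/
def bindW (Sig : Type) (m : ℕ) : List (Atom Sig) := (List.range m).map Atom.bvar

/-- The `m`-fold identity wire `Iₘ := μY.(λx₁…λxₘ/λx₁…λxₘ).Y : (m,m)`. -/
def idW (Sig : Type) (m : ℕ) : Term Sig :=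
  .mu m m (.pre (bindW Sig m) (bindW Sig m) (.pvar 0))

/-- The symmetry (twist) wire
`X_{k,l} := μY.(λx₁…λxₖλy₁…λyₗ / λy₁…λyₗλx₁…λxₖ).Y : (k+l, l+k)`. -/
def twistW (Sig : Type) (k l : ℕ) : Term Sig :=
  .mu (k + l) (l + k)
    (.pre (bindW Sig k ++ ((List.range l).map fun i => Atom.bvar (k + i)))
          (((List.range l).map fun i => Atom.bvar (k + i)) ++ bindW Sig k)
          (.pvar 0))

/-- The wire constant `d := μY.(ε/λxλx).Y : (0,2)`. -/
def dW (Sig : Type) : Term Sig := .mu 0 2 (.pre [] [.bvar 0, .bvar 0] (.pvar 0))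

/-- The wire constant `e := μY.(λxλx/ε).Y : (2,0)`. -/
def eW (Sig : Type) : Term Sig := .mu 2 0 (.pre [.bvar 0, .bvar 0] [] (.pvar 0))

/-- The trivial term `0 := μY.Y : (0,0)`. -/
def zeroW (Sig : Type) : Term Sig := .mu 0 0 (.pvar 0)

/-- `dₙ : (0,2n)`, recursively: `d₀ := 0`, `d₁ := d`, `d_{n+1} := d;(I⊗dₙ⊗I)`. -/
def dN (Sig : Type) : ℕ → Term Sig
  | 0 => zeroW Sig
  | 1 => dW Sig
  | n + 2 => .seq (dW Sig) (.ten (.ten (idW Sig 1) (dN Sig (n + 1))) (idW Sig 1))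

/-- `eₙ : (2n,0)`, recursively: `e₀ := 0`, `e₁ := e`, `e_{n+1} := (Iₙ⊗e⊗Iₙ);eₙ`. -/
def eN (Sig : Type) : ℕ → Term Sig
  | 0 => zeroW Sig
  | 1 => eW Sig
  | n + 2 => .seq (.ten (.ten (idW Sig (n + 1)) (eW Sig)) (idW Sig (n + 1)))
      (eN Sig (n + 1))

/-- `Iₙ` with the convention `I₀ := 0`. -/
def IN (Sig : Type) : ℕ → Term Sig
  | 0 => zeroW Sig
  | n + 1 => idW Sig (n + 1)

/-- The dualizing transformation `(-)*`; on prefix strings it is reversal. -/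
def Term.star : Term Sig → Term Sig
  | .pvar i => .pvar i
  | .seq P Q => .seq Q.star P.star
  | .ten P Q => .ten Q.star P.star
  | .pre u v P => .pre v.reverse u.reverse P.star
  | .choice P Q => .choice P.star Q.star
  | .mu k l P => .mu l k P.star

end WireCalc


namespace WireCalc

variable {Sig : Type}

theorem Bisim.refl (P : Term Sig) : Bisim P P := by
  refine ⟨Eq, ?_, ?_, rfl⟩
  · rintro P _ rfl a b P' h
    exact ⟨P', h, rfl⟩
  · rintro P _ rfl a b P' h
    exact ⟨P', h, rfl⟩

theorem Bisim.symm {P Q : Term Sig} : Bisim P Q → Bisim Q P :=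
  fun ⟨S, h, h', hPQ⟩ => ⟨flip S, h', h, hPQ⟩

theorem isSim_bisim : IsSim (Bisim (Sig := Sig)) := by
  rintro P Q ⟨S, h, h', hPQ⟩ a b P' hP
  obtain ⟨Q', hQ, hS⟩ := h P Q hPQ a b P' hP
  exact ⟨Q', hQ, S, h, h', hS⟩

theorem isIota_iotaW (k : ℕ) : IsIota (iotaW Sig k) :=
  fun _ hx => List.eq_of_mem_replicate hx

/-- Bisimilarity extended with choices of componentwise bisimilar terms. -/
inductive ChoiceBisim : Term Sig → Term Sig → Prop
  | base {P Q : Term Sig} : Bisim P Q → ChoiceBisim P Q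
  | choice {P Q R T : Term Sig} : Bisim P Q → Bisim R T →
      ChoiceBisim (.choice P R) (.choice Q T)

theorem ChoiceBisim.symm {X Y : Term Sig} (h : ChoiceBisim X Y) : ChoiceBisim Y X := by
  cases h with
  | base h => exact .base h.symm
  | choice h₁ h₂ => exact .choice h₁.symm h₂.symm

theorem ChoiceBisim.of_bisim_step {X Y X' : Term Sig} {a b : List (Option Sig)}
    (h : Bisim X Y) (hX : Step X a b X') : ∃ Y', Step Y a b Y' ∧ ChoiceBisim X' Y' := by
  obtain ⟨Y', hY, h'⟩ := isSim_bisim X Y h a b X' hX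
  exact ⟨Y', hY, .base h'⟩

theorem ChoiceBisim.choice_step {P Q R T : Term Sig} {a b : List (Option Sig)}
    (ha : IsIota a) (hb : IsIota b) (h₁ : Bisim P Q) (h₂ : Bisim R T) {P' R' : Term Sig}
    (hP : Step P a b P') (hR : Step R a b R') :
    ∃ Y, Step (.choice Q T) a b Y ∧ ChoiceBisim (.choice P' R') Y := by
  obtain ⟨Q', hQ, h₁'⟩ := isSim_bisim P Q h₁ a b P' hP
  obtain ⟨T', hT, h₂'⟩ := isSim_bisim R T h₂ a b R' hR
  exact ⟨_, .choiceIota ha hb hQ hT, .choice h₁' h₂'⟩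

theorem ChoiceBisim.exists_step {X X' : Term Sig} {a b : List (Option Sig)} (h : Step X a b X') :
    ∀ Y, ChoiceBisim X Y → ∃ Y', Step Y a b Y' ∧ ChoiceBisim X' Y' := by
  induction h with
  | refl hs =>
    rintro Y (h | ⟨h₁, h₂⟩)
    · exact of_bisim_step h (.refl hs)
    · cases hs with
      | choice hs₁ hs₂ =>
        exact choice_step (isIota_iotaW _) (isIota_iotaW _) h₁ h₂ (.refl hs₁) (.refl hs₂)
  | iotaL ha hb _ _ ih₁ ih₂ =>
    intro Y h
    obtain ⟨Z, hZ, h'⟩ := ih₁ Y h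
    obtain ⟨Y', hY, h''⟩ := ih₂ Z h'
    exact ⟨Y', .iotaL ha hb hZ hY, h''⟩
  | iotaR _ ha hb _ ih₁ ih₂ =>
    intro Y h
    obtain ⟨Z, hZ, h'⟩ := ih₁ Y h
    obtain ⟨Y', hY, h''⟩ := ih₂ Z h'
    exact ⟨Y', .iotaR hZ ha hb hY, h''⟩
  | cut hP hR =>
    rintro Y ⟨h⟩
    exact of_bisim_step h (.cut hP hR)
  | ten hP hR =>
    rintro Y ⟨h⟩
    exact of_bisim_step h (.ten hP hR)
  | pref σ hf =>
    rintro Y ⟨h⟩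
    exact of_bisim_step h (.pref σ hf)
  | choiceIota ha hb hP hR =>
    rintro Y (h | ⟨h₁, h₂⟩)
    · exact of_bisim_step h (.choiceIota ha hb hP hR)
    · exact choice_step ha hb h₁ h₂ hP hR
  | choiceL hn hP =>
    rintro Y (h | ⟨h₁, h₂⟩)
    · exact of_bisim_step h (.choiceL hn hP)
    · obtain ⟨Q', hQ, h'⟩ := of_bisim_step h₁ hP
      exact ⟨Q', .choiceL hn hQ, h'⟩
  | choiceR hn hR =>
    rintro Y (h | ⟨h₁, h₂⟩)
    · exact of_bisim_step h (.choiceR hn hR)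
    · obtain ⟨T', hT, h'⟩ := of_bisim_step h₂ hR
      exact ⟨T', .choiceR hn hT, h'⟩
  | recur hP =>
    rintro Y ⟨h⟩
    exact of_bisim_step h (.recur hP)

theorem Bisim.choice {P Q R T : Term Sig} (h₁ : Bisim P Q) (h₂ : Bisim R T) :
    Bisim (.choice P R) (.choice Q T) := by
  refine ⟨ChoiceBisim, fun X Y h a b X' hX => ChoiceBisim.exists_step hX Y h,
    fun X Y h a b X' hX => ?_, .choice h₁ h₂⟩
  obtain ⟨Y', hY, h'⟩ := ChoiceBisim.exists_step hX Y (ChoiceBisim.symm h)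
  exact ⟨Y', hY, h'.symm⟩

/-- bisimilarity is a congruence for choice. -/
theorem bisim_congr_choice {Sig : Type} {P Q R : Term Sig} {k l : ℕ}
    (hP : Sorted [] ∅ P k l) (hQ : Sorted [] ∅ Q k l) (hR : Sorted [] ∅ R k l)
    (h : Bisim P Q) :
    Bisim (.choice P R) (.choice Q R) ∧ Bisim (.choice R P) (.choice R Q) := by
  exact ⟨h.choice (.refl R), Bisim.choice (.refl R) h⟩

end WireCalc
end

section
/- Tensor in the wire calculus is associative up to bisimilarity: for closed sorted terms P : (k,l), R : (m,n), T : (u,v), one has (P⊗R)⊗T ∼ P⊗(R⊗T). -/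
namespace WireCalc

lemma iotaW_add (Sig : Type) (k m : ℕ) : iotaW Sig (k + m) = iotaW Sig k ++ iotaW Sig m :=
  List.replicate_add ..

lemma isIota_append {Sig : Type} {a b : List (Option Sig)} :
    IsIota (a ++ b) ↔ IsIota a ∧ IsIota b :=
  List.forall_mem_append

/-- Every transition of a tensor splits into transitions of its two components. -/
lemma Step.ten_inv {Sig : Type} {P R X : Term Sig} {a b : List (Option Sig)}
    (h : Step (.ten P R) a b X) :
    ∃ P' R' a₁ a₂ b₁ b₂, X = .ten P' R' ∧ a = a₁ ++ a₂ ∧ b = b₁ ++ b₂ ∧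
      Step P a₁ b₁ P' ∧ Step R a₂ b₂ R' := by
  generalize hY : Term.ten P R = Y at h
  induction h generalizing P R with
  | refl hs =>
    subst hY
    cases hs with
    | ten h₁ h₂ =>
      exact ⟨_, _, _, _, _, _, rfl, iotaW_add .., iotaW_add .., .refl h₁, .refl h₂⟩
  | iotaL ha hb _ _ ih₁ ih₂ =>
    obtain ⟨P₁, R₁, a₁, a₂, b₁, b₂, rfl, rfl, rfl, hP₁, hR₁⟩ := ih₁ hY
    obtain ⟨P₂, R₂, c₁, c₂, d₁, d₂, rfl, rfl, rfl, hP₂, hR₂⟩ := ih₂ rfl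
    rw [isIota_append] at ha hb
    exact ⟨_, _, _, _, _, _, rfl, rfl, rfl,
      .iotaL ha.1 hb.1 hP₁ hP₂, .iotaL ha.2 hb.2 hR₁ hR₂⟩
  | iotaR _ ha hb _ ih₁ ih₂ =>
    obtain ⟨P₁, R₁, a₁, a₂, b₁, b₂, rfl, rfl, rfl, hP₁, hR₁⟩ := ih₁ hY
    obtain ⟨P₂, R₂, c₁, c₂, d₁, d₂, rfl, rfl, rfl, hP₂, hR₂⟩ := ih₂ rfl
    rw [isIota_append] at ha hb
    exact ⟨_, _, _, _, _, _, rfl, rfl, rfl,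
      .iotaR hP₁ ha.1 hb.1 hP₂, .iotaR hR₁ ha.2 hb.2 hR₂⟩
  | ten h₁ h₂ =>
    cases hY
    exact ⟨_, _, _, _, _, _, rfl, rfl, rfl, h₁, h₂⟩
  | _ => cases hY

/-- tensor is associative up to bisimilarity. -/
theorem ten_assoc {Sig : Type} {P R T : Term Sig} {k l m n u v : ℕ}
    (hP : Sorted [] ∅ P k l) (hR : Sorted [] ∅ R m n) (hT : Sorted [] ∅ T u v) :
    Bisim (.ten (.ten P R) T) (.ten P (.ten R T)) := by
  refine ⟨fun X Y => ∃ P R T, X = .ten (.ten P R) T ∧ Y = .ten P (.ten R T), ?_, ?_,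
    P, R, T, rfl, rfl⟩
  · rintro _ _ ⟨P, R, T, rfl, rfl⟩ a b X h
    obtain ⟨_, T', _, a₃, _, b₃, rfl, rfl, rfl, hPR, hT⟩ := h.ten_inv
    obtain ⟨P', R', a₁, a₂, b₁, b₂, rfl, rfl, rfl, hP, hR⟩ := hPR.ten_inv
    refine ⟨.ten P' (.ten R' T'), ?_, P', R', T', rfl, rfl⟩
    rw [List.append_assoc, List.append_assoc]
    exact .ten hP (.ten hR hT)
  · rintro _ _ ⟨P, R, T, rfl, rfl⟩ a b X h
    obtain ⟨P', _, a₁, _, b₁, _, rfl, rfl, rfl, hP, hRT⟩ := h.ten_inv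
    obtain ⟨R', T', a₂, a₃, b₂, b₃, rfl, rfl, rfl, hR, hT⟩ := hRT.ten_inv
    refine ⟨.ten (.ten P' R') T', ?_, P', R', T', rfl, rfl⟩
    rw [← List.append_assoc, ← List.append_assoc]
    exact .ten (.ten hP hR) hT

end WireCalc
end

section
/- The snake (triangle) equations hold for n-fold wires up to bisimilarity: for all n ∈ ℕ, (dₙ⊗Iₙ);(Iₙ⊗eₙ) ∼ Iₙ and (Iₙ⊗dₙ);(eₙ⊗Iₙ) ∼ Iₙ, where d₀ = e₀ = I₀ := 0 (the term of sort (0,0)), d₁ := d, d_{n+1} := d;(I⊗dₙ⊗I), e₁ := e, and e_{n+1} := (Iₙ⊗e⊗Iₙ);eₙ. -/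
namespace WireCalc

/-! ## Stateless terms

A term is stateless with behaviour `R` when its labels, now and after any transitions,
are exactly those in the relation `R`. Such terms are classified up to bisimilarity by `R`,
and `R` is computed compositionally. -/

/-- A relation between words of label letters. -/
abbrev WordRel (Sig : Type) : Type := List (Option Sig) → List (Option Sig) → Prop

/-- The set of terms `W` is closed under transitions, and the labels of the transitions
of each of its members are exactly those in `R`. -/
def IsStatelessSet (R : WordRel Sig) (W : Term Sig → Prop) : Prop :=
  ∀ P, W P → (∀ a b Q, Step P a b Q → R a b ∧ W Q) ∧
    (∀ a b, R a b → ∃ Q, Step P a b Q ∧ W Q)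

/-- `P` is stateless with behaviour `R`. -/
def Stateless (R : WordRel Sig) (P : Term Sig) : Prop :=
  ∃ W, IsStatelessSet R W ∧ W P

theorem isStatelessSet_stateless (R : WordRel Sig) :
    IsStatelessSet R (Stateless R) := by
  rintro P ⟨W, hW, hP⟩
  refine ⟨fun a b Q h => ?_, fun a b h => ?_⟩
  · obtain ⟨hR, hQ⟩ := (hW P hP).1 a b Q h
    exact ⟨hR, W, hW, hQ⟩
  · obtain ⟨Q, h, hQ⟩ := (hW P hP).2 a b h
    exact ⟨Q, h, W, hW, hQ⟩

theorem Stateless.of_step {R : WordRel Sig} {P Q : Term Sig} {a b : List (Option Sig)}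
    (hP : Stateless R P) (h : Step P a b Q) : R a b ∧ Stateless R Q :=
  (isStatelessSet_stateless R P hP).1 a b Q h

theorem Stateless.exists_step {R : WordRel Sig} {P : Term Sig} {a b : List (Option Sig)}
    (hP : Stateless R P) (h : R a b) : ∃ Q, Step P a b Q ∧ Stateless R Q :=
  (isStatelessSet_stateless R P hP).2 a b h

theorem Stateless.congr {R S : WordRel Sig} {P : Term Sig} (hP : Stateless R P)
    (h : ∀ a b, R a b ↔ S a b) : Stateless S P := by
  have : R = S := by
    funext a b
    exact propext (h a b)
  exact this ▸ hP

theorem Stateless.bisim {R : WordRel Sig} {P Q : Term Sig}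
    (hP : Stateless R P) (hQ : Stateless R Q) : Bisim P Q := by
  refine ⟨fun P Q => Stateless R P ∧ Stateless R Q, ?_, ?_, hP, hQ⟩
  · rintro P Q ⟨hP, hQ⟩ a b P' h
    obtain ⟨hR, hP'⟩ := hP.of_step h
    obtain ⟨Q', h', hQ'⟩ := hQ.exists_step hR
    exact ⟨Q', h', hP', hQ'⟩
  · rintro P Q ⟨hQ, hP⟩ a b P' h
    obtain ⟨hR, hP'⟩ := hP.of_step h
    obtain ⟨Q', h', hQ'⟩ := hQ.exists_step hR
    exact ⟨Q', h', hQ', hP'⟩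

/-- Composition of word relations. -/
def seqRel (R S : WordRel Sig) : WordRel Sig :=
  fun a b => ∃ c, R a c ∧ S c b

/-- Parallel composition of word relations, by concatenation. -/
def tenRel (R S : WordRel Sig) : WordRel Sig :=
  fun a b => ∃ a₁ a₂ b₁ b₂, a = a₁ ++ a₂ ∧ b = b₁ ++ b₂ ∧ R a₁ b₁ ∧ S a₂ b₂

theorem Stateless.seq {R S : WordRel Sig} {P Q : Term Sig}
    (hP : Stateless R P) (hQ : Stateless S Q) : Stateless (seqRel R S) (.seq P Q) := by
  refine ⟨fun T => ∃ P Q, T = .seq P Q ∧ Stateless R P ∧ Stateless S Q, ?_, P, Q, rfl, hP, hQ⟩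
  intro T hT
  refine ⟨fun a b T' h => ?_, ?_⟩
  · induction h with
    | refl h =>
      refine ⟨?_, hT⟩
      obtain ⟨P, Q, rfl, hP, hQ⟩ := hT
      cases h with
      | seq h₁ h₂ => exact ⟨_, (hP.of_step (.refl h₁)).1, (hQ.of_step (.refl h₂)).1⟩
    | iotaL _ _ _ _ ih₁ ih₂ => exact ih₂ (ih₁ hT).2
    | iotaR _ _ _ _ ih₁ ih₂ => exact ⟨(ih₁ hT).1, (ih₂ (ih₁ hT).2).2⟩
    | cut h₁ h₂ =>
      obtain ⟨P, Q, h, hP, hQ⟩ := hT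
      cases h
      exact ⟨⟨_, (hP.of_step h₁).1, (hQ.of_step h₂).1⟩,
        _, _, rfl, (hP.of_step h₁).2, (hQ.of_step h₂).2⟩
    | _ =>
      obtain ⟨P, Q, h, -⟩ := hT
      cases h
  · obtain ⟨P, Q, rfl, hP, hQ⟩ := hT
    rintro a b ⟨c, h₁, h₂⟩
    obtain ⟨P', h₁', hP'⟩ := hP.exists_step h₁
    obtain ⟨Q', h₂', hQ'⟩ := hQ.exists_step h₂
    exact ⟨_, .cut h₁' h₂', _, _, rfl, hP', hQ'⟩

theorem Stateless.ten {R S : WordRel Sig} {P Q : Term Sig}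
    (hP : Stateless R P) (hQ : Stateless S Q) : Stateless (tenRel R S) (.ten P Q) := by
  refine ⟨fun T => ∃ P Q, T = .ten P Q ∧ Stateless R P ∧ Stateless S Q, ?_, P, Q, rfl, hP, hQ⟩
  intro T hT
  refine ⟨fun a b T' h => ?_, ?_⟩
  · induction h with
    | refl h =>
      refine ⟨?_, hT⟩
      obtain ⟨P, Q, rfl, hP, hQ⟩ := hT
      cases h with
      | ten h₁ h₂ =>
        exact ⟨_, _, _, _, by simp [iotaW], by simp [iotaW],
          (hP.of_step (.refl h₁)).1, (hQ.of_step (.refl h₂)).1⟩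
    | iotaL _ _ _ _ ih₁ ih₂ => exact ih₂ (ih₁ hT).2
    | iotaR _ _ _ _ ih₁ ih₂ => exact ⟨(ih₁ hT).1, (ih₂ (ih₁ hT).2).2⟩
    | ten h₁ h₂ =>
      obtain ⟨P, Q, h, hP, hQ⟩ := hT
      cases h
      exact ⟨⟨_, _, _, _, rfl, rfl, (hP.of_step h₁).1, (hQ.of_step h₂).1⟩,
        _, _, rfl, (hP.of_step h₁).2, (hQ.of_step h₂).2⟩
    | _ =>
      obtain ⟨P, Q, h, -⟩ := hT
      cases h
  · obtain ⟨P, Q, rfl, hP, hQ⟩ := hT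
    rintro a b ⟨a₁, a₂, b₁, b₂, rfl, rfl, h₁, h₂⟩
    obtain ⟨P', h₁', hP'⟩ := hP.exists_step h₁
    obtain ⟨Q', h₂', hQ'⟩ := hQ.exists_step h₂
    exact ⟨_, .ten h₁' h₂', _, _, rfl, hP', hQ'⟩

/-- The wire constant `μY.(λu/λv).Y` whose prefix consists of binders only. -/
def wire (Sig : Type) (u v : List ℕ) : Term Sig :=
  .mu u.length v.length (.pre (u.map .bvar) (v.map .bvar) (.pvar 0))

theorem substS_wire (σ : ℕ → Option (Option Sig)) (u v : List ℕ) :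
    (wire Sig u v).substS σ = wire Sig u v := by
  simp [wire, Term.substS, Atom.substS]

theorem sorted_pre_bvar {Γ : List (ℕ × ℕ)} {Δ : Set ℕ} {u v : List ℕ} {P : Term Sig} {k l : ℕ}
    (h : Sorted Γ Δ (.pre (u.map .bvar) (v.map .bvar) P) k l) :
    k = u.length ∧ l = v.length := by
  cases h with
  | pre hu hv => exact ⟨by simp [← hu], by simp [← hv]⟩

theorem stateless_wire (u v : List ℕ) :
    Stateless (fun a b => ∃ σ : ℕ → Option Sig, a = u.map σ ∧ b = v.map σ) (wire Sig u v) := by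
  refine ⟨fun T => T = wire Sig u v ∨ T = .pre (u.map .bvar) (v.map .bvar) (wire Sig u v),
    ?_, .inl rfl⟩
  have map_inst (σ : ℕ → Option Sig) (w : List ℕ) :
      (w.map Atom.bvar).map (instAtom σ) = w.map σ := by
    simp [instAtom, Function.comp_def]
  have hpre (σ : ℕ → Option Sig) :
      Step (.pre (u.map .bvar) (v.map .bvar) (wire Sig u v)) (u.map σ) (v.map σ)
        (wire Sig u v) := by
    have h := Step.pref (u := u.map .bvar) (v := v.map .bvar) (P := wire Sig u v) σ (by
      intro x hx
      simp only [← List.map_append, List.mem_map] at hx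
      obtain ⟨i, -, rfl⟩ := hx
      rfl)
    rwa [substS_wire, map_inst, map_inst] at h
  intro T hT
  refine ⟨fun a b T' h => ?_, ?_⟩
  · induction h with
    | @refl _ k l h =>
      refine ⟨⟨fun _ => none, ?_⟩, hT⟩
      have : k = u.length ∧ l = v.length := by
        rcases hT with rfl | rfl
        · cases h with
          | mu h => exact sorted_pre_bvar h
        · exact sorted_pre_bvar h
      simp [iotaW, this]
    | iotaL _ _ _ _ ih₁ ih₂ => exact ih₂ (ih₁ hT).2
    | iotaR _ _ _ _ ih₁ ih₂ => exact ⟨(ih₁ hT).1, (ih₂ (ih₁ hT).2).2⟩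
    | pref σ =>
      rcases hT with h | h
      · cases h
      · cases h
        exact ⟨⟨σ, map_inst σ u, map_inst σ v⟩, .inl (substS_wire _ u v)⟩
    | recur h ih =>
      rcases hT with h | h
      · cases h
        exact ih (.inr (by simp [substP, wire]))
      · cases h
    | _ => rcases hT with h | h <;> cases h
  · rintro a b ⟨σ, rfl, rfl⟩
    refine ⟨wire Sig u v, ?_, .inl rfl⟩
    rcases hT with rfl | rfl
    · exact .recur (by simpa [substP, wire] using hpre σ)
    · exact hpre σ

/-! ## Behaviours of the wire constants -/

/-- The behaviour of the `n`-fold identity wire. -/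
def idRel (Sig : Type) (n : ℕ) : WordRel Sig := fun a b => a.length = n ∧ b = a

/-- The behaviour of `dₙ`. -/
def dRel (Sig : Type) (n : ℕ) : WordRel Sig :=
  fun a b => a = [] ∧ ∃ w, w.length = n ∧ b = w ++ w.reverse

/-- The behaviour of `eₙ`. -/
def eRel (Sig : Type) (n : ℕ) : WordRel Sig :=
  fun a b => (∃ w, w.length = n ∧ a = w ++ w.reverse) ∧ b = []

theorem stateless_idW (n : ℕ) : Stateless (idRel Sig n) (idW Sig n) := by
  have h := stateless_wire (Sig := Sig) (List.range n) (List.range n)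
  simp only [wire, List.length_range] at h
  refine h.congr fun a b => ⟨?_, ?_⟩
  · rintro ⟨σ, rfl, rfl⟩
    exact ⟨by simp, rfl⟩
  · rintro ⟨rfl, rfl⟩
    have : b = (List.range b.length).map fun i => b[i]?.getD none := by
      apply List.ext_getElem <;> simp +contextual
    exact ⟨_, this, this⟩

theorem stateless_dW : Stateless (dRel Sig 1) (dW Sig) := by
  refine (stateless_wire (Sig := Sig) [] [0, 0]).congr fun a b => ⟨?_, ?_⟩
  · rintro ⟨σ, rfl, rfl⟩
    exact ⟨rfl, [σ 0], rfl, rfl⟩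
  · rintro ⟨rfl, w, hw, rfl⟩
    obtain ⟨x, rfl⟩ := List.length_eq_one_iff.1 hw
    exact ⟨fun _ => x, rfl, rfl⟩

theorem stateless_eW : Stateless (eRel Sig 1) (eW Sig) := by
  refine (stateless_wire (Sig := Sig) [0, 0] []).congr fun a b => ⟨?_, ?_⟩
  · rintro ⟨σ, rfl, rfl⟩
    exact ⟨⟨[σ 0], rfl, rfl⟩, rfl⟩
  · rintro ⟨⟨w, hw, rfl⟩, rfl⟩
    obtain ⟨x, rfl⟩ := List.length_eq_one_iff.1 hw
    exact ⟨fun _ => x, rfl, rfl⟩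

theorem stateless_zeroW : Stateless (fun a b => a = [] ∧ b = []) (zeroW Sig) := by
  refine ⟨fun T => T = zeroW Sig, ?_, rfl⟩
  intro T hT
  refine ⟨fun a b T' h => ?_, ?_⟩
  · induction h with
    | refl h =>
      refine ⟨?_, hT⟩
      subst hT
      rcases h with _ | _ | _ | _ | _ | ⟨⟨h⟩⟩
      simp only [List.getElem?_cons_zero, Option.some.injEq, Prod.mk.injEq] at h
      obtain ⟨rfl, rfl⟩ := h
      exact ⟨rfl, rfl⟩
    | iotaL _ _ _ _ ih₁ ih₂ => exact ih₂ (ih₁ hT).2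
    | iotaR _ _ _ _ ih₁ ih₂ => exact ⟨(ih₁ hT).1, (ih₂ (ih₁ hT).2).2⟩
    | recur h ih =>
      cases hT
      exact ih (by simp [substP, zeroW])
    | _ => cases hT
  · subst hT
    rintro a b ⟨rfl, rfl⟩
    exact ⟨zeroW Sig, .refl (k := 0) (l := 0) (.mu (.pvar rfl)), rfl⟩

theorem stateless_IN : ∀ n : ℕ, Stateless (idRel Sig n) (IN Sig n)
  | 0 => stateless_zeroW.congr fun a b => by
      simp only [idRel, List.length_eq_zero_iff]
      grind
  | n + 1 => stateless_idW (n + 1)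

theorem stateless_dN : ∀ n : ℕ, Stateless (dRel Sig n) (dN Sig n)
  | 0 => stateless_zeroW.congr fun a b => by simp [dRel]
  | 1 => stateless_dW
  | n + 2 => by
    refine (stateless_dW.seq (((stateless_idW 1).ten (stateless_dN (n + 1))).ten
      (stateless_idW 1))).congr fun a b => ⟨?_, ?_⟩
    · rintro ⟨_, ⟨rfl, w, hw, rfl⟩, _, _, _, _, h, rfl,
        ⟨_, _, _, _, rfl, rfl, ⟨hx, rfl⟩, rfl, v, hv, rfl⟩, hy, rfl⟩
      obtain ⟨z, rfl⟩ := List.length_eq_one_iff.1 hw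
      obtain ⟨x, rfl⟩ := List.length_eq_one_iff.1 hx
      obtain ⟨y, rfl⟩ := List.length_eq_one_iff.1 hy
      simp only [List.reverse_singleton, List.cons_append, List.nil_append,
        List.cons.injEq, and_true] at h
      obtain ⟨rfl, rfl⟩ := h
      exact ⟨rfl, z :: v, by simp [hv], by simp⟩
    · rintro ⟨rfl, _ | ⟨x, v⟩, hw, rfl⟩
      · simp at hw
      · exact ⟨[x, x], ⟨rfl, [x], rfl, rfl⟩, [x], [x], x :: (v ++ v.reverse), [x], rfl, by simp,
          ⟨[x], [], [x], _, rfl, rfl, ⟨rfl, rfl⟩, rfl, v, by simpa using hw, rfl⟩, rfl, rfl⟩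

theorem stateless_eN : ∀ n : ℕ, Stateless (eRel Sig n) (eN Sig n)
  | 0 => stateless_zeroW.congr fun a b => by simp [eRel]
  | 1 => stateless_eW
  | n + 2 => by
    refine ((((stateless_idW (n + 1)).ten stateless_eW).ten (stateless_idW (n + 1))).seq
      (stateless_eN (n + 1))).congr fun a b => ⟨?_, ?_⟩
    · rintro ⟨_, ⟨_, _, _, _, rfl, rfl, ⟨_, _, p, _, rfl, rfl, ⟨hp, rfl⟩, ⟨z, hz, rfl⟩, rfl⟩,
        hq, rfl⟩, ⟨w, hw, h⟩, rfl⟩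
      obtain ⟨x, rfl⟩ := List.length_eq_one_iff.1 hz
      rw [List.append_nil] at h
      obtain ⟨rfl, rfl⟩ := List.append_inj h (hp.trans hw.symm)
      exact ⟨⟨p ++ [x], by simp [hp], by simp⟩, rfl⟩
    · rintro ⟨⟨w, hw, rfl⟩, rfl⟩
      rcases List.eq_nil_or_concat w with rfl | ⟨v, x, rfl⟩
      · simp at hw
      · have hv : v.length = n + 1 := by simpa using hw
        exact ⟨v ++ v.reverse, ⟨v ++ [x, x], v.reverse, v, v.reverse, by simp, rfl,
          ⟨v, [x, x], v, [], rfl, by simp, ⟨hv, rfl⟩, ⟨[x], rfl, rfl⟩, rfl⟩,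
          by simpa using hv, rfl⟩, ⟨v, hv, rfl⟩, rfl⟩

/-! ## The snake equations -/

theorem snake_left_rel (n : ℕ) (a b : List (Option Sig)) :
    seqRel (tenRel (dRel Sig n) (idRel Sig n)) (tenRel (idRel Sig n) (eRel Sig n)) a b ↔
      idRel Sig n a b := by
  constructor
  · rintro ⟨_, ⟨_, q, _, _, rfl, rfl, ⟨rfl, w, hw, rfl⟩, hq, rfl⟩,
      p, _, _, _, h, rfl, ⟨hp, rfl⟩, ⟨v, hv, rfl⟩, rfl⟩
    rw [List.append_assoc] at h
    obtain ⟨rfl, h'⟩ := List.append_inj h (hw.trans hp.symm)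
    obtain ⟨rfl, rfl⟩ := List.append_inj h' (by simp [hw, hv])
    exact ⟨by simpa using hw, by simp⟩
  · rintro ⟨ha, rfl⟩
    exact ⟨b ++ b.reverse ++ b, ⟨[], b, _, b, rfl, rfl, ⟨rfl, b, ha, rfl⟩, ha, rfl⟩,
      b, b.reverse ++ b, b, [], by simp, by simp, ⟨ha, rfl⟩,
      ⟨b.reverse, by simpa using ha, by simp⟩, rfl⟩

theorem snake_right_rel (n : ℕ) (a b : List (Option Sig)) :
    seqRel (tenRel (idRel Sig n) (dRel Sig n)) (tenRel (eRel Sig n) (idRel Sig n)) a b ↔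
      idRel Sig n a b := by
  constructor
  · rintro ⟨_, ⟨p, _, _, _, rfl, rfl, ⟨hp, rfl⟩, rfl, w, hw, rfl⟩,
      _, q, _, _, h, rfl, ⟨⟨v, hv, rfl⟩, rfl⟩, hq, rfl⟩
    rw [List.append_assoc] at h
    obtain ⟨rfl, h'⟩ := List.append_inj h (hp.trans hv.symm)
    obtain ⟨rfl, rfl⟩ := List.append_inj h' (by simp [hw, hv])
    exact ⟨by simpa using hp, by simp⟩
  · rintro ⟨ha, rfl⟩
    exact ⟨b ++ (b.reverse ++ b), ⟨b, [], b, _, by simp, rfl, ⟨ha, rfl⟩, rfl,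
      b.reverse, by simpa using ha, by simp⟩,
      b ++ b.reverse, b, [], b, by simp, rfl, ⟨⟨b, ha, rfl⟩, rfl⟩, ha, rfl⟩

/-- the snake (triangle) equations for `n`-fold wires:
`(dₙ⊗Iₙ);(Iₙ⊗eₙ) ∼ Iₙ` and `(Iₙ⊗dₙ);(eₙ⊗Iₙ) ∼ Iₙ`, where
`d₀ = e₀ = I₀ := 0`. -/
theorem snake_n (Sig : Type) (n : ℕ) :
    Bisim (.seq (.ten (dN Sig n) (IN Sig n)) (.ten (IN Sig n) (eN Sig n)))
          (IN Sig n) ∧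
    Bisim (.seq (.ten (IN Sig n) (dN Sig n)) (.ten (eN Sig n) (IN Sig n)))
          (IN Sig n) := by
  have hI := stateless_IN (Sig := Sig) n
  have hd := stateless_dN (Sig := Sig) n
  have he := stateless_eN (Sig := Sig) n
  exact ⟨(((hd.ten hI).seq (hI.ten he)).congr (snake_left_rel n)).bisim hI,
    (((hI.ten hd).seq (he.ten hI)).congr (snake_right_rel n)).bisim hI⟩

end WireCalc
end
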